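/- Let B be a complex manifold satisfying the ∂∂̄-lemma (for example a Kähler manifold), and let k > 2. If α is a real closed k-form on B all of whose components have complex bidegree (p,q) with p ≥ 1 and q ≥ 1 (i.e. α lies in the truncated complex Ω_T^k(B)), and α = dβ for some (k−1)-form β on B, then α = dβ' for some real (k−1)-form β' lying in Ω_T^{k−1}(B). Equivalently, the natural map H^k(Ω_T(B); d) → H^k_{dR}(B) is injective for k > 2. -/

import Mathlib

/-!
Formalization of Lemma 5.4 of M. Bailey, *Symplectic foliations and generalized
complex structures* (arXiv:1203.6676): on a complex manifold satisfying the
`∂∂̄`-lemma (e.g. a Kähler manifold), the map from the cohomology of the truncated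
de Rham complex to de Rham cohomology is injective in degrees `k > 2`.
-/

/-- Abstract model of the bigraded algebra of complex-valued differential forms on a
complex manifold `B`: forms decompose by complex bidegree `(a, b)` with graded
projections `p a b`, complex conjugation `conj`, and `d = ∂ + ∂̄`. -/
structure DolbeaultSetting where
  /-- the complex-valued differential forms on `B` -/
  F : Type
  [addgrp : AddCommGroup F]
  [mod : Module ℂ F]
  /-- projection onto the component of bidegree `(a, b)` -/
  p : ℤ → ℤ → F →ₗ[ℂ] F
  /-- complex conjugation of forms -/
  conj : F →ₗ[ℝ] F
  /-- the Dolbeault operator `∂`, of bidegree `(1, 0)` -/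
  del : F →ₗ[ℂ] F
  /-- the conjugate Dolbeault operator `∂̄`, of bidegree `(0, 1)` -/
  delbar : F →ₗ[ℂ] F
  p_proj : ∀ a b x, p a b (p a b x) = p a b x
  p_orth : ∀ a b a' b' x, (a, b) ≠ (a', b') → p a b (p a' b' x) = 0
  /-- every form is the (finite) sum of its graded components -/
  p_total : ∀ x : F, ∃ s : Finset (ℤ × ℤ), x = s.sum fun t => p t.1 t.2 x
  conj_invol : ∀ x, conj (conj x) = x
  conj_smul : ∀ (c : ℂ) (x : F), conj (c • x) = (starRingEnd ℂ c) • conj x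
  conj_p : ∀ a b x, conj (p a b x) = p b a (conj x)
  del_deg : ∀ a b x, del (p a b x) = p (a+1) b (del (p a b x))
  delbar_deg : ∀ a b x, delbar (p a b x) = p a (b+1) (delbar (p a b x))
  conj_del : ∀ x, conj (del x) = delbar (conj x)
  d_squared : ∀ x, (del + delbar) ((del + delbar) x) = 0

attribute [instance] DolbeaultSetting.addgrp DolbeaultSetting.mod

namespace DolbeaultSetting

variable (C : DolbeaultSetting)

/-- The exterior derivative `d = ∂ + ∂̄`. -/
def d : C.F →ₗ[ℂ] C.F := C.del + C.delbar

/-- A form is real if it is fixed by complex conjugation. -/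
def IsReal (x : C.F) : Prop := C.conj x = x

/-- `x` is a differential form of total degree `k`. -/
def IsForm (k : ℤ) (x : C.F) : Prop := ∀ a b : ℤ, a + b ≠ k → C.p a b x = 0

/-- `x` lies in the truncated de Rham complex `Ω_T(B)`: all of its bidegree-`(a, b)`
components have `a ≥ 1` and `b ≥ 1`. -/
def InTruncated (x : C.F) : Prop := ∀ a b : ℤ, a ≤ 0 ∨ b ≤ 0 → C.p a b x = 0

/-- `B` satisfies the `∂∂̄`-lemma: a form which is `∂`-closed, `∂̄`-closed and
`d`-exact is `∂∂̄`-exact.  This holds, for example, when `B` is a compact Kähler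
manifold. -/
def DelDelbarLemma : Prop :=
  ∀ x : C.F, C.del x = 0 → C.delbar x = 0 → (∃ y, C.d y = x) →
    ∃ z, C.del (C.delbar z) = x

end DolbeaultSetting

namespace DolbeaultSetting

variable {C : DolbeaultSetting}

theorem p_p (a b a' b' : ℤ) (x : C.F) :
    C.p a b (C.p a' b' x) = if (a, b) = (a', b') then C.p a b x else 0 := by
  split_ifs with h
  · obtain ⟨rfl, rfl⟩ := Prod.mk.inj h
    exact C.p_proj _ _ x
  · exact C.p_orth _ _ _ _ x h

theorem ext_p {x y : C.F} (h : ∀ a b, C.p a b x = C.p a b y) : x = y := by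
  obtain ⟨s, hs⟩ := C.p_total (x - y)
  have h0 : x - y = 0 := by
    rw [hs]
    exact Finset.sum_eq_zero fun t _ => by rw [map_sub, h, sub_self]
  exact sub_eq_zero.mp h0

/-- Linear maps agreeing on all homogeneous forms are equal. -/
theorem linearMap_ext_p {f g : C.F →ₗ[ℂ] C.F}
    (h : ∀ a b x, f (C.p a b x) = g (C.p a b x)) : f = g := by
  ext x
  obtain ⟨s, hs⟩ := C.p_total x
  rw [hs, map_sum, map_sum]
  exact Finset.sum_congr rfl fun t _ => h _ _ x

theorem p_del (a b : ℤ) (x : C.F) : C.p a b (C.del x) = C.del (C.p (a - 1) b x) := by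
  refine LinearMap.congr_fun (f := C.p a b ∘ₗ C.del) (g := C.del ∘ₗ C.p (a - 1) b)
    (linearMap_ext_p fun a' b' y => ?_) x
  rw [LinearMap.comp_apply, LinearMap.comp_apply, C.del_deg a' b' y, p_p, p_p]
  by_cases h : (a, b) = (a' + 1, b')
  · obtain ⟨rfl, rfl⟩ := Prod.mk.inj h
    rw [if_pos rfl, if_pos (by simp), add_sub_cancel_right, ← C.del_deg]
  · have h' : ¬ (a - 1, b) = (a', b') := by
      simp only [Prod.mk.injEq] at h ⊢
      omega
    rw [if_neg h, if_neg h', map_zero]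

theorem p_delbar (a b : ℤ) (x : C.F) :
    C.p a b (C.delbar x) = C.delbar (C.p a (b - 1) x) := by
  refine LinearMap.congr_fun (f := C.p a b ∘ₗ C.delbar) (g := C.delbar ∘ₗ C.p a (b - 1))
    (linearMap_ext_p fun a' b' y => ?_) x
  rw [LinearMap.comp_apply, LinearMap.comp_apply, C.delbar_deg a' b' y, p_p, p_p]
  by_cases h : (a, b) = (a', b' + 1)
  · obtain ⟨rfl, rfl⟩ := Prod.mk.inj h
    rw [if_pos rfl, if_pos (by simp), add_sub_cancel_right, ← C.delbar_deg]
  · have h' : ¬ (a, b - 1) = (a', b') := by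
      simp only [Prod.mk.injEq] at h ⊢
      omega
    rw [if_neg h, if_neg h', map_zero]

theorem d_apply (x : C.F) : C.d x = C.del x + C.delbar x := rfl

theorem d_d (x : C.F) : C.d (C.d x) = 0 := C.d_squared x

theorem p_d (a b : ℤ) (x : C.F) :
    C.p a b (C.d x) = C.del (C.p (a - 1) b x) + C.delbar (C.p a (b - 1) x) := by
  rw [d_apply, map_add, p_del, p_delbar]

theorem del_del (x : C.F) : C.del (C.del x) = 0 := by
  refine LinearMap.congr_fun (f := C.del ∘ₗ C.del) (g := 0)
    (linearMap_ext_p fun a b y => ?_) x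
  have h := congrArg (C.p (a + 2) b) (C.d_d (C.p a b y))
  simpa [p_d, p_p, show a + 2 - 1 - 1 = a by omega, show a + 2 - 1 ≠ a by omega] using h

theorem del_delbar (x : C.F) : C.del (C.delbar x) = -C.delbar (C.del x) := by
  refine LinearMap.congr_fun (f := C.del ∘ₗ C.delbar) (g := -(C.delbar ∘ₗ C.del))
    (linearMap_ext_p fun a b y => ?_) x
  have h := congrArg (C.p (a + 1) (b + 1)) (C.d_d (C.p a b y))
  simp only [p_d, p_p, map_zero, add_sub_cancel_right, Prod.mk.injEq, add_eq_left,
    one_ne_zero, false_and, and_false, if_false, if_true, zero_add, add_zero] at h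
  exact eq_neg_of_add_eq_zero_left h

theorem d_del (x : C.F) : C.d (C.del x) = -C.del (C.delbar x) := by
  rw [d_apply, del_del, del_delbar, zero_add, neg_neg]

theorem conj_delbar (x : C.F) : C.conj (C.delbar x) = C.del (C.conj x) := by
  rw [← C.conj_invol (C.del (C.conj x)), C.conj_del, C.conj_invol]

theorem conj_d (x : C.F) : C.conj (C.d x) = C.d (C.conj x) := by
  rw [d_apply, d_apply, map_add, C.conj_del, conj_delbar, add_comm]

theorem p_conj (a b : ℤ) (x : C.F) : C.p a b (C.conj x) = C.conj (C.p b a x) :=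
  (C.conj_p b a x).symm

/-- The part of a form supported in a given set of bidegrees. -/
theorem exists_restrict (P : ℤ → ℤ → Prop) [∀ a b, Decidable (P a b)] (x : C.F) :
    ∃ y, ∀ a b, C.p a b y = if P a b then C.p a b x else 0 := by
  obtain ⟨s, hs⟩ := C.p_total x
  refine ⟨∑ t ∈ s with P t.1 t.2, C.p t.1 t.2 x, fun a b => ?_⟩
  have hx : C.p a b x = ∑ t ∈ s, if (a, b) = t then C.p a b x else 0 := by
    conv_lhs => rw [hs]
    simp only [map_sum, p_p]
  simp only [map_sum, p_p, Finset.sum_ite_eq] at hx ⊢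
  by_cases hs' : (a, b) ∈ s
  · simp [hs']
  · rw [if_neg hs'] at hx
    simp [hx]

/-- A real exact form has a real primitive of the same degree. -/
theorem exists_real_primitive {k : ℤ} {α β : C.F} (hα : C.IsReal α) (hβ : C.IsForm k β)
    (h : C.d β = α) : ∃ γ, C.IsReal γ ∧ C.IsForm k γ ∧ C.d γ = α := by
  refine ⟨(2⁻¹ : ℂ) • (β + C.conj β), ?_, fun a b hab => ?_, ?_⟩
  · rw [IsReal, C.conj_smul, map_add, C.conj_invol, add_comm, map_inv₀, map_ofNat]
  · rw [map_smul, map_add, p_conj, hβ a b hab, hβ b a (by omega)]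
    simp
  · rw [map_smul, map_add, ← conj_d, h, show C.conj α = α from hα, ← two_smul ℂ α,
      inv_smul_smul₀ two_ne_zero]

/-- The part in bidegrees `(a, b)`, `a ≤ 0`, of a primitive of a truncated form has
the same differential as a form of bidegree `(1, k - 1)`. -/
theorem exists_d_eq_of_nonpos_part (hlemma : C.DelDelbarLemma) {k : ℤ} {β β₀ : C.F}
    (hβ : C.IsForm k β) (htrunc : C.InTruncated (C.d β))
    (hβ₀ : ∀ a b, C.p a b β₀ = if a ≤ 0 then C.p a b β else 0) :
    ∃ η, C.d η = C.d β₀ ∧ C.p 1 (k - 1) η = η := by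
  have hu : C.d β₀ = C.del (C.p 0 k β) := by
    refine ext_p fun a b => ?_
    rw [p_d, p_del, hβ₀, hβ₀, p_p]
    rcases lt_trichotomy a 1 with ha | rfl | ha
    · have h := htrunc a b (by omega)
      rw [p_d] at h
      rw [if_pos (by omega), if_pos (by omega), if_neg (by simp; omega), h, map_zero]
    · by_cases hb : b = k
      · subst hb
        simp
      · simp [hb, hβ 0 b (by omega)]
    · rw [if_neg (by omega), if_neg (by omega), if_neg (by simp; omega)]
      simp
  have hdel : C.del (C.d β₀) = 0 := by rw [hu, del_del]
  have hdelbar : C.delbar (C.d β₀) = 0 := by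
    have h := C.d_d β₀
    rwa [d_apply (C.d β₀), hdel, zero_add] at h
  obtain ⟨z, hz⟩ := hlemma _ hdel hdelbar ⟨β₀, rfl⟩
  have hz' : C.del (C.delbar (C.p 0 (k - 1) z)) = C.d β₀ := by
    have h := congrArg (C.p 1 k) hz
    rw [p_del, p_delbar, hu, p_del, p_p] at h
    simpa [hu] using h
  refine ⟨-C.del (C.p 0 (k - 1) z), ?_, ?_⟩
  · rw [map_neg, d_del, hz', neg_neg]
  · rw [map_neg, p_del, sub_self, C.p_proj]

end DolbeaultSetting

/-- **Lemma 5.4 of the paper.**  Let `B` be a complex manifold satisfying the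
`∂∂̄`-lemma (for example a Kähler manifold), and let `k > 2`.  If `α` is a real closed
`k`-form on `B` lying in the truncated complex `Ω_T^k(B)` (all of its `(a, b)`
components have `a ≥ 1` and `b ≥ 1`) which is exact, `α = dβ` for some
`(k−1)`-form `β`, then `α = dβ'` for some real `(k−1)`-form `β'` lying in
`Ω_T^{k−1}(B)`.  Equivalently, the natural map
`H^k(Ω_T(B); d) → H^k_{dR}(B)` is injective for `k > 2`. -/
theorem truncated_to_deRham_injective
    (C : DolbeaultSetting) (hlemma : C.DelDelbarLemma)
    (k : ℤ) (hk : 2 < k) (α β : C.F)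
    (hα_real : C.IsReal α) (hα_deg : C.IsForm k α) (hα_trunc : C.InTruncated α)
    (hα_closed : C.d α = 0)
    (hβ_deg : C.IsForm (k - 1) β) (hβ : C.d β = α) :
    ∃ β' : C.F, C.IsReal β' ∧ C.IsForm (k - 1) β' ∧ C.InTruncated β' ∧
      C.d β' = α := by
  classical
  obtain ⟨γ, hγ_real, hγ_deg, hγ⟩ := DolbeaultSetting.exists_real_primitive hα_real hβ_deg hβ
  obtain ⟨γ₀, hγ₀⟩ := DolbeaultSetting.exists_restrict (fun a _ => a ≤ 0) γ
  obtain ⟨η, hη, hη_deg⟩ := DolbeaultSetting.exists_d_eq_of_nonpos_part hlemma hγ_deg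
    (by rwa [hγ]) hγ₀
  have hη_p : ∀ a b, ¬ (a = 1 ∧ b = k - 1 - 1) → C.p a b η = 0 := fun a b h => by
    rw [← hη_deg, DolbeaultSetting.p_p, if_neg (by simpa using h)]
  have hγ_real' : C.conj γ = γ := hγ_real
  refine ⟨γ - (γ₀ - η) - C.conj (γ₀ - η), ?_, fun a b hab => ?_, fun a b hab => ?_, ?_⟩
  · simp only [DolbeaultSetting.IsReal, map_sub, C.conj_invol, hγ_real']
    abel
  · simp only [map_sub, DolbeaultSetting.p_conj, hγ₀, hη_p a b (by omega), hη_p b a (by omega),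
      hγ_deg a b hab, hγ_deg b a (by omega)]
    simp
  · simp only [map_sub, DolbeaultSetting.p_conj, hγ₀, hη_p a b (by omega), hη_p b a (by omega)]
    by_cases hk' : a + b = k - 1
    · have hconj : C.conj (C.p b a γ) = C.p a b γ := by
        rw [C.conj_p, hγ_real']
      rcases hab with h | h
      · rw [if_pos h, if_neg (by omega)]
        simp
      · rw [if_neg (by omega), if_pos h, hconj]
        simp
    · rw [hγ_deg a b hk', hγ_deg b a (by omega)]
      simp
  · rw [map_sub, map_sub, ← DolbeaultSetting.conj_d, map_sub, hη, hγ]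
    simp
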